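/- Let H be a real Hilbert space and f : H → ℝ ∪ {+∞} a proper lower semicontinuous convex function. Assume there exists x̂ ∈ H such that ∂°f(x̂) = p_f, the Crandall–Pazy direction of f. Then the curve η(t) = x̂ − t·p_f, t ∈ [0, +∞), is the subgradient curve of f emanating from x̂; in particular, for every t ≥ 0 one has p_f ∈ ∂f(x̂ − t·p_f) and ∂°f(x̂ − t·p_f) = p_f. -/

import Mathlib

open Set Filter MeasureTheory RealInnerProductSpace
open scoped ENNReal NNReal Classical

variable {H : Type*} [NormedAddCommGroup H] [InnerProductSpace ℝ H] [CompleteSpace H]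

/-- The convex subdifferential of an extended-real-valued function `f` at `x`. -/
def SubdiffE (f : H → EReal) (x : H) : Set H :=
  {p | ∀ y, f x + ((⟪p, y - x⟫ : ℝ) : EReal) ≤ f y}

/-- Convexity for extended-real-valued functions. -/
def ConvexE (f : H → EReal) : Prop :=
  ∀ x y : H, ∀ a b : ℝ, 0 ≤ a → 0 ≤ b → a + b = 1 →
    f (a • x + b • y) ≤ (a : EReal) * f x + (b : EReal) * f y

/-- The element of minimal norm of a set (defined when it exists, `0` otherwise).
For a nonempty closed convex subset of a Hilbert space this is the projection of `0`. -/
noncomputable def minNormElt (S : Set H) : H :=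
  if h : ∃ p ∈ S, ∀ q ∈ S, ‖p‖ ≤ ‖q‖ then h.choose else 0

/-- The slope of `f` at `x`: `dist(0, ∂f(x))`, with value `⊤` when `∂f(x) = ∅`. -/
noncomputable def slopeE (f : H → EReal) (x : H) : ℝ≥0∞ :=
  ⨅ p ∈ SubdiffE f x, (‖p‖₊ : ℝ≥0∞)

/-- `γ : [0,∞) → H` is the subgradient curve of `f` emanating from `x`:
a locally absolutely continuous curve with `γ 0 = x` and `γ' t ∈ -∂f(γ t)` a.e. -/
def IsSubgradientCurve (f : H → EReal) (x : H) (γ : ℝ → H) : Prop :=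
  γ 0 = x ∧ ContinuousOn γ (Set.Ici 0) ∧
  ∃ v : ℝ → H,
    (∀ t > 0, MeasureTheory.IntegrableOn v (Set.Ioc 0 t)) ∧
    (∀ t ≥ 0, γ t = x + ∫ s in Set.Ioc 0 t, v s) ∧
    (∀ᵐ t ∂(MeasureTheory.volume.restrict (Set.Ioi (0:ℝ))), -v t ∈ SubdiffE f (γ t))

open scoped Topology

section Subdifferential

omit [CompleteSpace H]

theorem SubdiffE.ne_top {f : H → EReal} (hproper : ∃ y, f y ≠ ⊤) {x p : H}
    (hp : p ∈ SubdiffE f x) : f x ≠ ⊤ := by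
  obtain ⟨y, hy⟩ := hproper
  intro hx
  have := hp y
  rw [hx, EReal.top_add_coe, top_le_iff] at this
  exact hy this

theorem mem_SubdiffE_iff_toReal {f : H → EReal} (hnobot : ∀ y, f y ≠ ⊥) {x p : H}
    (hx : f x ≠ ⊤) :
    p ∈ SubdiffE f x ↔ ∀ y, f y ≠ ⊤ → (f x).toReal + ⟪p, y - x⟫ ≤ (f y).toReal := by
  refine forall_congr' fun y => ?_
  by_cases hy : f y = ⊤
  · simp [hy]
  · simp only [hy, ne_eq, not_false_eq_true, true_imp_iff]
    conv_lhs => rw [← EReal.coe_toReal hx (hnobot x), ← EReal.coe_toReal hy (hnobot y)]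
    norm_cast

/-- The subdifferential is a monotone operator. -/
theorem SubdiffE.inner_sub_nonneg {f : H → EReal} (hproper : ∃ y, f y ≠ ⊤)
    (hnobot : ∀ y, f y ≠ ⊥) {x y p q : H} (hp : p ∈ SubdiffE f x) (hq : q ∈ SubdiffE f y) :
    0 ≤ (⟪p - q, x - y⟫ : ℝ) := by
  have hx := SubdiffE.ne_top hproper hp
  have hy := SubdiffE.ne_top hproper hq
  have h1 := (mem_SubdiffE_iff_toReal hnobot hx).1 hp y hy
  have h2 := (mem_SubdiffE_iff_toReal hnobot hy).1 hq x hx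
  simp only [inner_sub_left, inner_sub_right] at *
  linarith

theorem ConvexE.toReal_le {f : H → EReal} (hnobot : ∀ y, f y ≠ ⊥) (hconv : ConvexE f)
    {x y : H} (hx : f x ≠ ⊤) (hy : f y ≠ ⊤) {a b : ℝ} (ha : 0 ≤ a) (hb : 0 ≤ b)
    (hab : a + b = 1) :
    f (a • x + b • y) ≠ ⊤ ∧
      (f (a • x + b • y)).toReal ≤ a * (f x).toReal + b * (f y).toReal := by
  have h := hconv x y a b ha hb hab
  rw [← EReal.coe_toReal hx (hnobot x), ← EReal.coe_toReal hy (hnobot y)] at h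
  have h' : f (a • x + b • y) ≤ ((a * (f x).toReal + b * (f y).toReal : ℝ) : EReal) := by
    exact_mod_cast h
  have htop : f (a • x + b • y) ≠ ⊤ := ne_top_of_le_ne_top (EReal.coe_ne_top _) h'
  refine ⟨htop, ?_⟩
  rwa [← EReal.coe_toReal htop (hnobot _), EReal.coe_le_coe_iff] at h'

/-- First-order optimality condition for the proximal problem. -/
theorem smul_sub_mem_SubdiffE_of_isMinOn {f : H → EReal} (hnobot : ∀ y, f y ≠ ⊥)
    (hconv : ConvexE f) {x z : H} {t : ℝ} (ht : 0 < t) (hz : f z ≠ ⊤)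
    (hmin : IsMinOn (fun y => (f y).toReal + (2 * t)⁻¹ * ‖y - x‖ ^ 2) {y | f y ≠ ⊤} z) :
    t⁻¹ • (x - z) ∈ SubdiffE f z := by
  rw [mem_SubdiffE_iff_toReal hnobot hz]
  intro y hy
  have key : ∀ s ∈ Ioo (0 : ℝ) 1,
      (f z).toReal + ⟪t⁻¹ • (x - z), y - z⟫ ≤
        (f y).toReal + s * ((2 * t)⁻¹ * ‖y - z‖ ^ 2) := by
    rintro s ⟨hs0, hs1⟩
    obtain ⟨hw, hle⟩ := hconv.toReal_le hnobot hz hy (sub_nonneg.2 hs1.le) hs0.le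
      (sub_add_cancel 1 s)
    have hm := isMinOn_iff.1 hmin _ hw
    have hexp : ‖(1 - s) • z + s • y - x‖ ^ 2
        = ‖z - x‖ ^ 2 - 2 * s * ⟪x - z, y - z⟫ + s ^ 2 * ‖y - z‖ ^ 2 := by
      have : (1 - s) • z + s • y - x = s • (y - z) - (x - z) := by module
      rw [this, norm_sub_sq_real, norm_smul, real_inner_smul_left, real_inner_comm,
        norm_sub_rev x z, mul_pow, Real.norm_eq_abs, sq_abs]
      ring
    rw [hexp] at hm
    have hmul : s * ((f z).toReal + ⟪t⁻¹ • (x - z), y - z⟫) ≤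
        s * ((f y).toReal + s * ((2 * t)⁻¹ * ‖y - z‖ ^ 2)) := by
      rw [real_inner_smul_left]
      have : (2 * t)⁻¹ = t⁻¹ / 2 := by field_simp
      rw [this] at hm ⊢
      linarith
    exact le_of_mul_le_mul_left hmul hs0
  have hlim : Tendsto (fun s : ℝ => (f y).toReal + s * ((2 * t)⁻¹ * ‖y - z‖ ^ 2)) (𝓝[>] 0)
      (𝓝 ((f y).toReal + 0 * ((2 * t)⁻¹ * ‖y - z‖ ^ 2))) :=
    (Continuous.tendsto (by fun_prop) 0).mono_left nhdsWithin_le_nhds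
  rw [zero_mul, add_zero] at hlim
  exact ge_of_tendsto hlim
    (Filter.mem_of_superset (Ioo_mem_nhdsGT one_pos) key)

/-- The midpoint inequality for the proximal energy. -/
theorem ConvexE.norm_sub_sq_le_of_prox {f : H → EReal} (hnobot : ∀ y, f y ≠ ⊥)
    (hconv : ConvexE f) {x a b : H} {c m δ : ℝ} (hc : 0 < c)
    (hm : ∀ y, f y ≠ ⊤ → m ≤ (f y).toReal + c * ‖y - x‖ ^ 2)
    (ha : f a ≠ ⊤) (hb : f b ≠ ⊤)
    (ham : (f a).toReal + c * ‖a - x‖ ^ 2 ≤ m + δ)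
    (hbm : (f b).toReal + c * ‖b - x‖ ^ 2 ≤ m + δ) :
    ‖a - b‖ ^ 2 ≤ 4 * δ / c := by
  obtain ⟨hw, hle⟩ := hconv.toReal_le hnobot ha hb (a := 1 / 2) (b := 1 / 2) (by norm_num)
    (by norm_num) (by norm_num)
  have hmid := hm _ hw
  have hpar := parallelogram_law_with_norm ℝ (a - x) (b - x)
  have h1 : (1 / 2 : ℝ) • a + (1 / 2 : ℝ) • b - x
      = (1 / 2 : ℝ) • ((a - x) + (b - x)) := by module
  have h2 : ‖(1 / 2 : ℝ) • a + (1 / 2 : ℝ) • b - x‖ ^ 2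
      = 1 / 4 * ‖(a - x) + (b - x)‖ ^ 2 := by
    rw [h1, norm_smul, mul_pow]
    norm_num
  rw [h2] at hmid
  rw [sub_sub_sub_cancel_right] at hpar
  rw [le_div_iff₀ hc]
  have hpar' : c * ‖a - b‖ ^ 2
      = 2 * (c * ‖a - x‖ ^ 2 + c * ‖b - x‖ ^ 2) - c * ‖(a - x) + (b - x)‖ ^ 2 := by
    linear_combination c * hpar
  linarith

end Subdifferential

/-- The proximal map is defined at every point where `f` has a subgradient. -/
theorem exists_smul_sub_mem_SubdiffE {f : H → EReal} (hproper : ∃ y, f y ≠ ⊤)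
    (hnobot : ∀ y, f y ≠ ⊥) (hlsc : LowerSemicontinuous f) (hconv : ConvexE f)
    {x p : H} (hp : p ∈ SubdiffE f x) {t : ℝ} (ht : 0 < t) :
    ∃ z, t⁻¹ • (x - z) ∈ SubdiffE f z := by
  have hx := SubdiffE.ne_top hproper hp
  set c : ℝ := (2 * t)⁻¹
  have hc : 0 < c := by positivity
  set g : H → ℝ := fun y => (f y).toReal + c * ‖y - x‖ ^ 2 with hg
  have hbdd : BddBelow (g '' {y | f y ≠ ⊤}) := by
    refine ⟨(f x).toReal - ‖p‖ ^ 2 / (4 * c), ?_⟩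
    rintro _ ⟨y, hy, rfl⟩
    have h1 := (mem_SubdiffE_iff_toReal hnobot hx).1 hp y hy
    have h2 := neg_le_of_abs_le (abs_real_inner_le_norm p (y - x))
    have h3 : ‖p‖ ^ 2 / (4 * c) - ‖p‖ * ‖y - x‖ + c * ‖y - x‖ ^ 2
        = (‖p‖ - 2 * c * ‖y - x‖) ^ 2 / (4 * c) := by
      field_simp
      ring
    have h4 : 0 ≤ (‖p‖ - 2 * c * ‖y - x‖) ^ 2 / (4 * c) := by positivity
    simp only [hg]
    linarith
  have hne : (g '' {y | f y ≠ ⊤}).Nonempty := ⟨_, x, hx, rfl⟩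
  set m := sInf (g '' {y | f y ≠ ⊤})
  have hm : ∀ y, f y ≠ ⊤ → m ≤ g y := fun y hy => csInf_le hbdd ⟨y, hy, rfl⟩
  have hex : ∀ n : ℕ, ∃ y, f y ≠ ⊤ ∧ g y ≤ m + 1 / ((n : ℝ) + 1) := by
    intro n
    obtain ⟨_, ⟨y, hy, rfl⟩, hlt⟩ := exists_lt_of_csInf_lt hne
      (lt_add_of_pos_right m (Nat.one_div_pos_of_nat (α := ℝ) (n := n)))
    exact ⟨y, hy, hlt.le⟩
  choose u hu hum using hex
  have hcauchy : CauchySeq u := by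
    refine cauchySeq_of_le_tendsto_0 (fun n : ℕ => √(4 * (1 / ((n : ℝ) + 1)) / c)) ?_ ?_
    · intro i j N hi hj
      rw [dist_eq_norm]
      refine Real.le_sqrt_of_sq_le ?_
      refine hconv.norm_sub_sq_le_of_prox hnobot hc hm (hu i) (hu j) ?_ ?_
      · exact (hum i).trans (by gcongr)
      · exact (hum j).trans (by gcongr)
    · have h := ((tendsto_one_div_add_atTop_nhds_zero_nat (𝕜 := ℝ)).const_mul 4).div_const c
      simpa using h.sqrt
  obtain ⟨z, hz⟩ := cauchySeq_tendsto_of_complete hcauchy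
  have hub : Tendsto (fun n : ℕ => m + 1 / ((n : ℝ) + 1) - c * ‖u n - x‖ ^ 2) atTop
      (𝓝 (m - c * ‖z - x‖ ^ 2)) := by
    have h1 := (tendsto_one_div_add_atTop_nhds_zero_nat (𝕜 := ℝ)).const_add m
    have h2 := (((hz.sub_const x).norm).pow 2).const_mul c
    simpa using h1.sub h2
  have hfz : f z ≤ ((m - c * ‖z - x‖ ^ 2 : ℝ) : EReal) := by
    refine EReal.le_of_forall_lt_iff_le.1 fun r hr => ?_
    by_contra hlt
    rw [not_le] at hlt
    have h1 := hz.eventually (hlsc z _ hlt)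
    have h2 := hub.eventually (gt_mem_nhds (EReal.coe_lt_coe_iff.1 hr))
    obtain ⟨n, h1, h2⟩ := (h1.and h2).exists
    rw [← EReal.coe_toReal (hu n) (hnobot _), gt_iff_lt, EReal.coe_lt_coe_iff] at h1
    have := hum n
    simp only [hg] at this
    linarith
  have hztop : f z ≠ ⊤ := ne_top_of_le_ne_top (EReal.coe_ne_top _) hfz
  refine ⟨z, smul_sub_mem_SubdiffE_of_isMinOn hnobot hconv ht hztop ?_⟩
  rw [isMinOn_iff]
  intro y hy
  rw [← EReal.coe_toReal hztop (hnobot _), EReal.coe_le_coe_iff] at hfz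
  have := hm y hy
  simp only [hg] at this
  linarith

/-- If `p` is a subgradient at `x` of minimal norm in the whole range of the subdifferential,
then `p` is a subgradient along the ray `x - t • p`. -/
theorem mem_SubdiffE_sub_smul {f : H → EReal} (hproper : ∃ y, f y ≠ ⊤)
    (hnobot : ∀ y, f y ≠ ⊥) (hlsc : LowerSemicontinuous f) (hconv : ConvexE f)
    {x p : H} (hp : p ∈ SubdiffE f x) (hmin : ∀ y, ∀ q ∈ SubdiffE f y, ‖p‖ ≤ ‖q‖)
    {t : ℝ} (ht : 0 ≤ t) : p ∈ SubdiffE f (x - t • p) := by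
  rcases ht.eq_or_lt with rfl | ht
  · simpa using hp
  obtain ⟨z, hz⟩ := exists_smul_sub_mem_SubdiffE hproper hnobot hlsc hconv hp ht
  set q := t⁻¹ • (x - z) with hq
  have hxz : x - z = t • q := by rw [hq, smul_inv_smul₀ ht.ne']
  have hmono := SubdiffE.inner_sub_nonneg hproper hnobot hp hz
  rw [hxz, real_inner_smul_right] at hmono
  have hinner : ‖q‖ ^ 2 ≤ ⟪p, q⟫ := by
    have := nonneg_of_mul_nonneg_right hmono ht
    rw [inner_sub_left, real_inner_self_eq_norm_sq] at this
    linarith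
  have hnorm := hmin z q hz
  have hpq : p = q := by
    have h := norm_sub_sq_real p q
    have h' : ‖p - q‖ ^ 2 ≤ 0 := by nlinarith [norm_nonneg p, norm_nonneg q]
    rw [← sub_eq_zero, ← norm_eq_zero]
    exact pow_eq_zero_iff two_ne_zero |>.1 (le_antisymm h' (sq_nonneg _))
  have hzx : x - t • p = z := by rw [hpq, ← hxz, sub_sub_cancel]
  rw [hzx, hpq]
  exact hz

theorem AbsolutelyContinuousOnInterval.of_dist_le {X Y : Type*} [PseudoMetricSpace X]
    [PseudoMetricSpace Y] {f : ℝ → X} {g : ℝ → Y} {a b : ℝ}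
    (hg : AbsolutelyContinuousOnInterval g a b)
    (h : ∀ x ∈ uIcc a b, ∀ y ∈ uIcc a b, dist (f x) (f y) ≤ dist (g x) (g y)) :
    AbsolutelyContinuousOnInterval f a b := by
  rw [absolutelyContinuousOnInterval_iff] at hg ⊢
  intro ε hε
  obtain ⟨δ, hδ, H⟩ := hg ε hε
  refine ⟨δ, hδ, fun E hE hlt => (Finset.sum_le_sum fun i hi => ?_).trans_lt (H E hE hlt)⟩
  exact h _ (hE.1 i hi).1 _ (hE.1 i hi).2

omit [CompleteSpace H] in
/-- The norm of a primitive of an integrable function is absolutely continuous. -/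
theorem IntervalIntegrable.absolutelyContinuousOnInterval_norm_integral {u : ℝ → H} {a b : ℝ}
    (hu : IntervalIntegrable u volume a b) :
    AbsolutelyContinuousOnInterval (fun x => ‖∫ s in a..x, u s‖) a b := by
  refine (hu.norm.absolutelyContinuousOnInterval_intervalIntegral left_mem_uIcc).of_dist_le ?_
  intro x hx y hy
  have hax := hu.mono_set (uIcc_subset_uIcc_left hx)
  have hay := hu.mono_set (uIcc_subset_uIcc_left hy)
  rw [Real.dist_eq, Real.dist_eq, intervalIntegral.integral_interval_sub_left hax.norm hay.norm]
  refine (abs_norm_sub_norm_le _ _).trans ?_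
  rw [intervalIntegral.integral_interval_sub_left hax hay]
  exact intervalIntegral.norm_integral_le_abs_integral_norm

/-- A primitive vanishing at `0` whose derivative is a.e. non-positively correlated with it is
identically zero. -/
theorem integral_eq_zero_of_ae_inner_nonpos {u : ℝ → H} {T : ℝ} (hT : 0 ≤ T)
    (hu : IntervalIntegrable u volume 0 T)
    (h : ∀ᵐ t, t ∈ Ioc 0 T → (⟪∫ s in (0 : ℝ)..t, u s, u t⟫ : ℝ) ≤ 0) :
    ∫ s in (0 : ℝ)..T, u s = 0 := by
  have hN := hu.absolutelyContinuousOnInterval_norm_integral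
  have hftc := (hN.fun_mul hN).integral_deriv_eq_sub
  have hle : ∫ t in (0 : ℝ)..T, deriv (fun x => ‖∫ s in (0 : ℝ)..x, u s‖ *
      ‖∫ s in (0 : ℝ)..x, u s‖) t ≤ 0 := by
    rw [intervalIntegral.integral_of_le hT]
    refine integral_nonpos_of_ae ?_
    rw [EventuallyLE, ae_restrict_iff' measurableSet_Ioc]
    filter_upwards [h, hu.ae_hasDerivAt_integral] with t ht hd htm
    have hd' := (hd (Ioc_subset_Icc_self.trans Icc_subset_uIcc htm) 0 left_mem_uIcc).norm_sq
    simp only [← pow_two]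
    rw [hd'.deriv]
    have := ht htm
    simp only [Pi.zero_apply]
    linarith
  rw [hftc] at hle
  simp only [intervalIntegral.integral_same, norm_zero, mul_zero, sub_zero] at hle
  rw [← norm_eq_zero]
  exact mul_self_eq_zero.1 (le_antisymm hle (mul_self_nonneg _))

/-- **The subgradient curve is a ray when the Crandall–Pazy direction is attained.**
Let `f : H → ℝ ∪ {+∞}` be proper lsc convex with Crandall–Pazy direction `pf` (element
of minimal norm of the closure of the range of the subdifferential). If `∂°f(x̂) = pf`
at some point `x̂` (i.e. `pf ∈ ∂f(x̂)` and `pf` has minimal norm there), then the ray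
`η t = x̂ - t • pf` is the (unique) subgradient curve of `f` emanating from `x̂`; in
particular, for every `t ≥ 0`, `pf ∈ ∂f(x̂ - t • pf)` and `∂°f(x̂ - t • pf) = pf`. -/
theorem ray_is_subgradient_curve_of_CP_attained
    (f : H → EReal)
    (hproper : ∃ y, f y ≠ ⊤) (hnobot : ∀ y, f y ≠ ⊥)
    (hlsc : LowerSemicontinuous f) (hconv : ConvexE f)
    (pf : H)
    (hpf : pf ∈ closure (⋃ y, SubdiffE f y) ∧
      ∀ q ∈ closure (⋃ y, SubdiffE f y), ‖pf‖ ≤ ‖q‖)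
    (xhat : H)
    (hmem : pf ∈ SubdiffE f xhat)
    (hmin : ∀ q ∈ SubdiffE f xhat, ‖pf‖ ≤ ‖q‖) :
    IsSubgradientCurve f xhat (fun t => xhat - t • pf) ∧
    (∀ γ : ℝ → H, IsSubgradientCurve f xhat γ → ∀ t ≥ (0:ℝ), γ t = xhat - t • pf) ∧
    (∀ t ≥ (0:ℝ), pf ∈ SubdiffE f (xhat - t • pf) ∧
      ∀ q ∈ SubdiffE f (xhat - t • pf), ‖pf‖ ≤ ‖q‖) := by
  have hrange : ∀ y, ∀ q ∈ SubdiffE f y, ‖pf‖ ≤ ‖q‖ := fun y q hq =>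
    hpf.2 q (subset_closure (mem_iUnion.2 ⟨y, hq⟩))
  have hray : ∀ t ≥ (0 : ℝ), pf ∈ SubdiffE f (xhat - t • pf) := fun t ht =>
    mem_SubdiffE_sub_smul hproper hnobot hlsc hconv hmem hrange ht
  refine ⟨⟨by simp, by fun_prop, fun _ => -pf, ?_, ?_, ?_⟩, ?_,
    fun t ht => ⟨hray t ht, hrange _⟩⟩
  · exact fun t _ => integrableOn_const measure_Ioc_lt_top.ne
  · intro t ht
    simp [ht, sub_eq_add_neg]
  · filter_upwards [ae_restrict_mem measurableSet_Ioi] with t ht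
    simpa using hray t (le_of_lt ht)
  · rintro γ ⟨hγ0, -, v, hvint, hγ, hv⟩ t ht
    rcases ht.eq_or_lt with rfl | htpos
    · simpa using hγ0
    have hvi : ∀ s ≥ (0 : ℝ), IntervalIntegrable v volume 0 s := by
      intro s hs
      rcases hs.eq_or_lt with rfl | hs'
      · exact IntervalIntegrable.refl
      · exact (intervalIntegrable_iff_integrableOn_Ioc_of_le hs).2 (hvint s hs')
    have hG : ∀ s ≥ (0 : ℝ), ∫ r in (0 : ℝ)..s, (v r + pf) = γ s - (xhat - s • pf) := by
      intro s hs
      rw [intervalIntegral.integral_add (hvi s hs) intervalIntegrable_const,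
        intervalIntegral.integral_const, intervalIntegral.integral_of_le hs, hγ s hs, sub_zero]
      abel
    have hzero := integral_eq_zero_of_ae_inner_nonpos ht
      ((hvi t ht).add (intervalIntegrable_const (c := pf))) (by
        rw [ae_restrict_iff' measurableSet_Ioi] at hv
        filter_upwards [hv] with s hs hsm
        have hmono := SubdiffE.inner_sub_nonneg hproper hnobot (hs hsm.1) (hray s hsm.1.le)
        rw [hG s hsm.1.le, real_inner_comm]
        rw [← neg_add', inner_neg_left] at hmono
        linarith)
    rw [hG t ht] at hzero
    exact sub_eq_zero.1 hzero
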